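/- In the fragmented-society model with the dynamic adjustment process, every limit point σ of the sequence (σ_t) induces the same joint distribution over policy–coalition pairs (a,C) as the unique essential equilibrium σ*. -/

import Mathlib

open Finset
open scoped Classical

/-- A policy: `l` (the "populist" policy ℓ) or `h` (the rational policy). -/
inductive Policy where
  | l : Policy
  | h : Policy
  deriving DecidableEq

instance : Fintype Policy :=
  ⟨{Policy.l, Policy.h}, fun x => by cases x <;> simp⟩

/-- A narrative `S ⊆ {0,…,n}`: the first component records whether the policy
variable (index 0) belongs to `S`, the second records `S ∩ N`. -/
abbrev Narrative (n : ℕ) := Bool × Finset (Fin n)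

/-- A platform: a policy, a coalition of social groups, and a narrative. -/
abbrev Platform (n : ℕ) := Policy × Finset (Fin n) × Narrative n

namespace FN

variable {n : ℕ}

/-- The true narrative `S = {0}`. -/
def trueNarr (n : ℕ) : Narrative n := (true, ∅)

/-- The denialist narrative `S = ∅`. -/
def denialNarr (n : ℕ) : Narrative n := (false, ∅)

/-- `x_S(a,C) = x_S(a',C')`: the variables postulated by the narrative `S` take the
same values at `(a,C)` and `(a',C')`. -/
def Agrees (S : Narrative n) (a : Policy) (C : Finset (Fin n))
    (a' : Policy) (C' : Finset (Fin n)) : Prop :=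
  (S.1 = true → a = a') ∧ ∀ i ∈ S.2, (i ∈ C ↔ i ∈ C')

/-- The long-run conditional probability `p_σ(y = 1 ∣ x_S(a,C))`: using
`Pr(y=1∣h) = q`, `Pr(y=1∣ℓ) = 0`, it is `q` times the σ-mass of platforms with
policy `h` agreeing with `(a,C)` on `S`, divided by the σ-mass of all platforms
agreeing with `(a,C)` on `S`. -/
noncomputable def condProb (q : ℝ) (σ : Platform n → ℝ) (a : Policy)
    (C : Finset (Fin n)) (S : Narrative n) : ℝ :=
  (q * ∑ z ∈ univ.filter (fun z : Platform n =>
      z.1 = Policy.h ∧ Agrees S a C z.1 z.2.1), σ z) /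
    ∑ z ∈ univ.filter (fun z : Platform n => Agrees S a C z.1 z.2.1), σ z

/-- The platform payoff `U_σ(a,C,S) = Σ_{i∈C} p_σ(y=1∣x_S(a,C)) · f_i(a)`. -/
noncomputable def payoff (q : ℝ) (f : Fin n → Policy → ℝ) (σ : Platform n → ℝ)
    (z : Platform n) : ℝ :=
  ∑ i ∈ z.2.1, condProb q σ z.1 z.2.1 z.2.2 * f i z.1

/-- A coalition `C` is admissible given policy `a` if it is a nonempty strict
subset of `N` and every member intrinsically supports `a`. -/
def Admissible (f : Fin n → Policy → ℝ) (a : Policy) (C : Finset (Fin n)) : Prop :=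
  C.Nonempty ∧ C ≠ univ ∧ ∀ i ∈ C, 0 < f i a

/-- A valid platform: admissible coalition and feasible narrative. -/
def Valid (f : Fin n → Policy → ℝ) (feas : Narrative n → Prop) (z : Platform n) : Prop :=
  Admissible f z.1 z.2.1 ∧ feas z.2.2

/-- `σ` is a probability distribution over platforms. -/
def IsDist (σ : Platform n → ℝ) : Prop :=
  (∀ z, 0 ≤ σ z) ∧ ∑ z, σ z = 1

/-- An ε-equilibrium: a full-support distribution (over valid platforms) such that
every platform with probability above ε maximizes the payoff among valid platforms. -/
def EpsEquilibrium (q : ℝ) (f : Fin n → Policy → ℝ) (feas : Narrative n → Prop)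
    (ε : ℝ) (σ : Platform n → ℝ) : Prop :=
  IsDist σ ∧ (∀ z, 0 < σ z ↔ Valid f feas z) ∧
    ∀ z, Valid f feas z → ε < σ z →
      ∀ z', Valid f feas z' → payoff q f σ z' ≤ payoff q f σ z

/-- An equilibrium: a (pointwise) limit of ε-equilibria as ε → 0. -/
def Equilibrium (q : ℝ) (f : Fin n → Policy → ℝ) (feas : Narrative n → Prop)
    (σ : Platform n → ℝ) : Prop :=
  ∃ (ε : ℕ → ℝ) (σs : ℕ → Platform n → ℝ),
    (∀ k, 0 < ε k) ∧ Filter.Tendsto ε Filter.atTop (nhds 0) ∧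
    (∀ k, EpsEquilibrium q f feas (ε k) (σs k)) ∧
    (∀ z, Filter.Tendsto (fun k => σs k z) Filter.atTop (nhds (σ z)))

/-- An essential equilibrium: supported platforms with a false narrative strictly
outperform the true narrative on the same policy-coalition pair, and supported
narratives `S ⊆ N` strictly outperform all strict subset narratives. -/
def Essential (q : ℝ) (f : Fin n → Policy → ℝ) (feas : Narrative n → Prop)
    (σ : Platform n → ℝ) : Prop :=
  Equilibrium q f feas σ ∧
  (∀ a C (S : Narrative n), 0 < σ (a, C, S) → S ≠ trueNarr n →
      payoff q f σ (a, C, trueNarr n) < payoff q f σ (a, C, S)) ∧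
  (∀ a C (S : Finset (Fin n)), 0 < σ (a, C, ((false, S) : Narrative n)) →
      ∀ S' : Finset (Fin n), S' ⊂ S →
        payoff q f σ (a, C, ((false, S') : Narrative n)) <
          payoff q f σ (a, C, ((false, S) : Narrative n)))

/-- `N^a`: the set of groups with positive mobilization potential for `a`. -/
noncomputable def Nset (f : Fin n → Policy → ℝ) (a : Policy) : Finset (Fin n) :=
  univ.filter (fun i => 0 < f i a)

/-- `F(a,M) = Σ_{i∈M} f_i(a)`: the aggregate mobilization potential for `a` in `M`. -/
def Fval (f : Fin n → Policy → ℝ) (a : Policy) (M : Finset (Fin n)) : ℝ :=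
  ∑ i ∈ M, f i a

/-- Standing assumptions on the mobilization potentials: nonnegativity, every group
supports some policy, every policy is supported by some group. -/
def FOK (f : Fin n → Policy → ℝ) : Prop :=
  (∀ i a, 0 ≤ f i a) ∧ (∀ i, ∃ a, 0 < f i a) ∧ (∀ a, ∃ i, 0 < f i a)

/-- Standing assumptions on the family `𝒮` in the fragmented-society model. -/
def FamilyOK (f : Fin n → Policy → ℝ) (𝒮 : Finset (Finset (Fin n))) : Prop :=
  (univ \ Nset f Policy.h).Nonempty ∧ (univ \ Nset f Policy.l).Nonempty ∧
  (Nset f Policy.l ∩ Nset f Policy.h).Nonempty ∧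
  univ \ Nset f Policy.h ∈ 𝒮 ∧ univ \ Nset f Policy.l ∈ 𝒮 ∧
  Nset f Policy.l ∩ Nset f Policy.h ∈ 𝒮 ∧ (∅ : Finset (Fin n)) ∈ 𝒮 ∧
  ∀ S ∈ 𝒮, S ⊆ univ \ Nset f Policy.h ∨ S ⊆ univ \ Nset f Policy.l ∨
    S ⊆ Nset f Policy.l ∩ Nset f Policy.h

/-- In the fragmented-society model, a narrative is feasible iff `S ∖ {0} ∈ 𝒮`. -/
def fragFeas (𝒮 : Finset (Finset (Fin n))) : Narrative n → Prop :=
  fun S => S.2 ∈ 𝒮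

end FN

set_option linter.unusedSectionVars false
set_option linter.unusedVariables false

namespace FN

variable {n : ℕ}

noncomputable def SA (f : Fin n → Policy → ℝ) (𝒮 : Finset (Finset (Fin n))) :
    Finset (Finset (Fin n)) := 𝒮.filter (fun S => S ⊆ univ \ Nset f Policy.h)

noncomputable def Hm (σ : Platform n → ℝ) : ℝ :=
  ∑ z ∈ univ.filter (fun z : Platform n => z.1 = Policy.h), σ z

noncomputable def nu (σ : Platform n → ℝ) (S : Finset (Fin n)) : ℝ :=
  ∑ z ∈ univ.filter (fun z : Platform n => z.1 = Policy.l ∧ Disjoint z.2.1 S), σ z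

def Good (f : Fin n → Policy → ℝ) (𝒮 : Finset (Finset (Fin n))) (z : Platform n) : Prop :=
  z.1 = Policy.l ∧ z.2.2.1 = false ∧ z.2.2.2 ∈ 𝒮 ∧
    ((z.2.2.2 ⊆ univ \ Nset f Policy.h ∧ z.2.1 = Nset f Policy.l \ z.2.2.2) ∨
     (z.2.2.2 ⊆ Nset f Policy.l ∩ Nset f Policy.h ∧ z.2.1 = Nset f Policy.l))

noncomputable def mu (f : Fin n → Policy → ℝ) (𝒮 : Finset (Finset (Fin n)))
    (σ : Platform n → ℝ) (S : Finset (Fin n)) : ℝ :=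
  ∑ z ∈ univ.filter (fun z : Platform n => Good f 𝒮 z ∧ z.2.1 = Nset f Policy.l \ S), σ z

noncomputable def badm (f : Fin n → Policy → ℝ) (𝒮 : Finset (Finset (Fin n)))
    (σ : Platform n → ℝ) : ℝ :=
  ∑ z ∈ univ.filter (fun z : Platform n => z.1 = Policy.l ∧ ¬ Good f 𝒮 z), σ z

noncomputable def hoff (f : Fin n → Policy → ℝ) (σ : Platform n → ℝ) : ℝ :=
  ∑ z ∈ univ.filter (fun z : Platform n => z.1 = Policy.h ∧ z.2.1 ≠ Nset f Policy.h), σ z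

def WOK (f : Fin n → Policy → ℝ) (𝒮 : Finset (Finset (Fin n))) (σ : Platform n → ℝ) : Prop :=
  (∀ z, 0 ≤ σ z) ∧ ∀ z, ¬ Valid f (fragFeas 𝒮) z → σ z = 0

theorem mem_Nset {f : Fin n → Policy → ℝ} {a : Policy} {i : Fin n} :
    i ∈ Nset f a ↔ 0 < f i a := by simp [Nset]

theorem Nset_or {f : Fin n → Policy → ℝ} (hf : FOK f) (i : Fin n) :
    i ∈ Nset f Policy.l ∨ i ∈ Nset f Policy.h := by
  obtain ⟨a, ha⟩ := hf.2.1 i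
  cases a
  · left; exact mem_Nset.2 ha
  · right; exact mem_Nset.2 ha

theorem adm_sub {f : Fin n → Policy → ℝ} {a : Policy} {C : Finset (Fin n)}
    (h : Admissible f a C) : C ⊆ Nset f a := fun i hi => mem_Nset.2 (h.2.2 i hi)

theorem Fval_mono {f : Fin n → Policy → ℝ} (hf : FOK f) {a : Policy} {C D : Finset (Fin n)}
    (h : C ⊆ D) : Fval f a C ≤ Fval f a D :=
  Finset.sum_le_sum_of_subset_of_nonneg h (fun i _ _ => hf.1 i a)

theorem Fval_pos {f : Fin n → Policy → ℝ} {a : Policy} {C : Finset (Fin n)}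
    (h : C.Nonempty) (h2 : C ⊆ Nset f a) : 0 < Fval f a C :=
  Finset.sum_pos (fun i hi => mem_Nset.1 (h2 hi)) h

theorem Fval_eq_of_le {f : Fin n → Policy → ℝ} {a : Policy} {C D : Finset (Fin n)}
    (h : C ⊆ D) (hD : D ⊆ Nset f a) (hle : Fval f a D ≤ Fval f a C) : C = D := by
  by_contra hne
  have hs : (D \ C).Nonempty := by
    rw [Finset.sdiff_nonempty]
    exact fun h' => hne (Finset.Subset.antisymm h h')
  have h1 : 0 < Fval f a (D \ C) := Fval_pos hs (Finset.sdiff_subset.trans hD)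
  have h2 : Fval f a (D \ C) + Fval f a C = Fval f a D := Finset.sum_sdiff h
  linarith

theorem payoff_eq (q : ℝ) (f : Fin n → Policy → ℝ) (σ : Platform n → ℝ) (z : Platform n) :
    payoff q f σ z = condProb q σ z.1 z.2.1 z.2.2 * Fval f z.1 z.2.1 := by
  simp [payoff, Fval, Finset.mul_sum]

theorem agrees_refl (S : Narrative n) (a : Policy) (C : Finset (Fin n)) : Agrees S a C a C :=
  ⟨fun _ => rfl, fun _ _ => Iff.rfl⟩

/-- denominator -/
noncomputable def den (σ : Platform n → ℝ) (a : Policy) (C : Finset (Fin n)) (S : Narrative n) : ℝ :=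
  ∑ z ∈ univ.filter (fun z : Platform n => Agrees S a C z.1 z.2.1), σ z

noncomputable def num (σ : Platform n → ℝ) (a : Policy) (C : Finset (Fin n)) (S : Narrative n) : ℝ :=
  ∑ z ∈ univ.filter (fun z : Platform n => z.1 = Policy.h ∧ Agrees S a C z.1 z.2.1), σ z

theorem condProb_def (q : ℝ) (σ : Platform n → ℝ) (a : Policy) (C : Finset (Fin n))
    (S : Narrative n) : condProb q σ a C S = q * num σ a C S / den σ a C S := rfl

section
variable {σ : Platform n → ℝ} (h0 : ∀ z, 0 ≤ σ z)
include h0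

theorem num_nonneg (a : Policy) (C : Finset (Fin n)) (S : Narrative n) : 0 ≤ num σ a C S :=
  Finset.sum_nonneg fun z _ => h0 z

theorem num_le_den (a : Policy) (C : Finset (Fin n)) (S : Narrative n) :
    num σ a C S ≤ den σ a C S := by
  apply Finset.sum_le_sum_of_subset_of_nonneg
  · intro z; simp only [Finset.mem_filter]; tauto
  · intro z _ _; exact h0 z

theorem le_den (z : Platform n) : σ z ≤ den σ z.1 z.2.1 z.2.2 := by
  apply Finset.single_le_sum (f := σ) (fun z _ => h0 z)
  simp [agrees_refl]

theorem condProb_le {q : ℝ} (hq : 0 < q) (a : Policy) (C : Finset (Fin n)) (S : Narrative n) :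
    condProb q σ a C S ≤ q := by
  rw [condProb_def]
  have h1 := num_le_den h0 a C S
  have h2 := num_nonneg h0 a C S
  apply div_le_of_le_mul₀ (h2.trans h1) hq.le
  exact mul_le_mul_of_nonneg_left h1 hq.le

theorem condProb_true {q : ℝ} {C : Finset (Fin n)} 
    (h : 0 < σ (Policy.h, C, trueNarr n)) : condProb q σ Policy.h C (trueNarr n) = q := by
  have e : num σ Policy.h C (trueNarr n) = den σ Policy.h C (trueNarr n) := by
    unfold num den
    congr 1
    ext z
    simp [Agrees, trueNarr, eq_comm]
  have h1 := le_den h0 (Policy.h, C, trueNarr n)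
  have h2 : den σ Policy.h C (trueNarr n) ≠ 0 := (lt_of_lt_of_le h h1).ne'
  rw [condProb_def, e, mul_div_assoc, div_self h2, mul_one]

end

theorem agrees_congr {S : Narrative n} {a : Policy} {C C' : Finset (Fin n)}
    (h : ∀ i ∈ S.2, (i ∈ C ↔ i ∈ C')) (b : Policy) (D : Finset (Fin n)) :
    Agrees S a C b D ↔ Agrees S a C' b D := by
  unfold Agrees
  refine and_congr Iff.rfl (forall₂_congr fun i hi => ?_)
  rw [h i hi]

theorem condProb_congr (q : ℝ) (σ : Platform n → ℝ) {S : Narrative n} {a : Policy}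
    {C C' : Finset (Fin n)} (h : ∀ i ∈ S.2, (i ∈ C ↔ i ∈ C')) :
    condProb q σ a C S = condProb q σ a C' S := by
  unfold condProb
  simp only [agrees_congr h]

section
variable {f : Fin n → Policy → ℝ} (hf : FOK f) {𝒮 : Finset (Finset (Fin n))} (h𝒮 : FamilyOK f 𝒮)
include hf h𝒮

theorem Vpos : 0 < Fval f Policy.h (Nset f Policy.h) := by
  obtain ⟨i, hi⟩ := hf.2.2 Policy.h
  exact Fval_pos ⟨i, mem_Nset.2 hi⟩ (Finset.Subset.refl _)

theorem A_sub_Nl : univ \ Nset f Policy.h ⊆ Nset f Policy.l := by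
  intro i hi
  rcases Nset_or hf i with h | h
  · exact h
  · simp [h] at hi

theorem adm_of {C : Finset (Fin n)} (h1 : Nset f Policy.l ∩ Nset f Policy.h ⊆ C)
    (h2 : C ⊆ Nset f Policy.l) : Admissible f Policy.l C := by
  refine ⟨h𝒮.2.2.1.mono h1, ?_, fun i hi => mem_Nset.1 (h2 hi)⟩
  rintro rfl
  obtain ⟨i, hi⟩ := h𝒮.2.1
  simp at hi
  exact hi (h2 (mem_univ i))

theorem M_sub {S : Finset (Fin n)} (hS : S ⊆ univ \ Nset f Policy.h) :
    Nset f Policy.l ∩ Nset f Policy.h ⊆ Nset f Policy.l \ S := by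
  intro i hi
  rw [Finset.mem_inter] at hi
  rw [Finset.mem_sdiff]
  refine ⟨hi.1, fun h => ?_⟩
  have := hS h
  simp [hi.2] at this

theorem adm_h : Admissible f Policy.h (Nset f Policy.h) := by
  obtain ⟨i, hi⟩ := hf.2.2 Policy.h
  refine ⟨⟨i, mem_Nset.2 hi⟩, ?_, fun i hi => mem_Nset.1 hi⟩
  intro h
  obtain ⟨i, hi⟩ := h𝒮.1
  simp [h] at hi

theorem valid_true : Valid f (fragFeas 𝒮) (Policy.h, Nset f Policy.h, trueNarr n) :=
  ⟨adm_h hf h𝒮, h𝒮.2.2.2.2.2.2.1⟩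

theorem valid_A {S : Finset (Fin n)} (hS : S ∈ SA f 𝒮) :
    Valid f (fragFeas 𝒮) (Policy.l, Nset f Policy.l \ S, (false, S)) := by
  rw [SA, Finset.mem_filter] at hS
  exact ⟨adm_of hf h𝒮 (M_sub hf h𝒮 hS.2) Finset.sdiff_subset, hS.1⟩

theorem classify {q : ℝ} (hq : 0 < q) {σ : Platform n → ℝ} (hσ : WOK f 𝒮 σ) {C : Finset (Fin n)}
    {S : Narrative n} (hv : Valid f (fragFeas 𝒮) (Policy.l, C, S))
    (hp : q * Fval f Policy.h (Nset f Policy.h) ≤ payoff q f σ (Policy.l, C, S))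
    (hmax : ∀ C', Admissible f Policy.l C' →
      condProb q σ Policy.l C' S = condProb q σ Policy.l C S →
        payoff q f σ (Policy.l, C', S) ≤ payoff q f σ (Policy.l, C, S)) :
    Good f 𝒮 (Policy.l, C, S) ∨
      σ (Policy.l, C, S) * Fval f Policy.h (Nset f Policy.h) ≤
        hoff f σ * Fval f Policy.l (Nset f Policy.l) := by
  have hV := Vpos hf h𝒮
  have hC : C ⊆ Nset f Policy.l := adm_sub hv.1
  have hFC : 0 < Fval f Policy.l C := Fval_pos hv.1.1 hC
  have hFle : Fval f Policy.l C ≤ Fval f Policy.l (Nset f Policy.l) := Fval_mono hf hC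
  simp only [payoff_eq] at hp hmax
  have hpp : 0 < condProb q σ Policy.l C S := by
    by_contra hneg
    push Not at hneg
    have := mul_nonpos_of_nonpos_of_nonneg hneg hFC.le
    have := mul_pos hq hV
    linarith
  by_cases hN : Agrees S Policy.l C Policy.h (Nset f Policy.h)
  · left
    have hS1 : S.1 = false := by
      by_contra h
      have := hN.1 (by simpa using h)
      cases this
    have key : ∀ C', C ⊆ C' → C' ⊆ Nset f Policy.l → Admissible f Policy.l C' →
        (∀ i ∈ S.2, (i ∈ C' ↔ i ∈ C)) → C = C' := by
      intro C' h1 h2 h3 h4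
      have e := condProb_congr q σ (a := Policy.l) h4
      have := hmax C' h3 e
      rw [e] at this
      exact Fval_eq_of_le h1 h2 (le_of_mul_le_mul_left this hpp)
    have caseA : S.2 ⊆ univ \ Nset f Policy.h → Good f 𝒮 (Policy.l, C, S) := by
      intro hSA
      refine ⟨rfl, hS1, hv.2, Or.inl ⟨hSA, ?_⟩⟩
      have hd : ∀ i ∈ S.2, i ∉ C := by
        intro i hi hiC
        have h1 := (hN.2 i hi).1 hiC
        have h2 := hSA hi
        simp [h1] at h2
      apply key
      · intro i hi
        exact Finset.mem_sdiff.2 ⟨hC hi, fun h => hd i h hi⟩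
      · exact Finset.sdiff_subset
      · exact adm_of hf h𝒮 (M_sub hf h𝒮 hSA) Finset.sdiff_subset
      · intro i hi
        simp [hi, hd i hi]
    rcases h𝒮.2.2.2.2.2.2.2 S.2 hv.2 with h | h | h
    · exact caseA h
    · apply caseA
      intro i hi
      exfalso
      have h1 := h hi
      rw [Finset.mem_sdiff] at h1
      have h2 := (Nset_or hf i).resolve_left h1.2
      exact h1.2 (hC ((hN.2 i hi).2 h2))
    · refine ⟨rfl, hS1, hv.2, Or.inr ⟨h, ?_⟩⟩
      apply key _ hC (Finset.Subset.refl _) (adm_of hf h𝒮 Finset.inter_subset_left (Finset.Subset.refl _))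
      intro i hi
      have h1 := h hi
      rw [Finset.mem_inter] at h1
      exact ⟨fun _ => (hN.2 i hi).2 h1.2, fun h => hC h⟩
  · right
    have hnum : num σ Policy.l C S ≤ hoff f σ := by
      apply Finset.sum_le_sum_of_subset_of_nonneg
      · intro z
        simp only [Finset.mem_filter, Finset.mem_univ, true_and]
        rintro ⟨h1, h2⟩
        refine ⟨h1, fun h3 => hN ?_⟩
        rwa [h1, h3] at h2
      · intro z _ _; exact hσ.1 z
    have hd := le_den hσ.1 (Policy.l, C, S)
    simp only at hd
    rw [condProb_def] at hpp hp
    have hnn := num_nonneg hσ.1 Policy.l C S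
    have hden : 0 < den σ Policy.l C S := by
      rcases (hnn.trans (num_le_den hσ.1 Policy.l C S)).lt_or_eq with h | h
      · exact h
      · rw [← h] at hpp; simp at hpp
    have h1 : q * (Fval f Policy.h (Nset f Policy.h) * den σ Policy.l C S) ≤
        q * (num σ Policy.l C S * Fval f Policy.l C) := by
      have := mul_le_mul_of_nonneg_right hp hden.le
      calc _ = q * Fval f Policy.h (Nset f Policy.h) * den σ Policy.l C S := by ring
        _ ≤ _ := this
        _ = _ := by field_simp
    have h2 := le_of_mul_le_mul_left h1 hq
    calc σ (Policy.l, C, S) * Fval f Policy.h (Nset f Policy.h)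
        ≤ den σ Policy.l C S * Fval f Policy.h (Nset f Policy.h) := by gcongr
      _ ≤ num σ Policy.l C S * Fval f Policy.l C := by linarith
      _ ≤ hoff f σ * Fval f Policy.l (Nset f Policy.l) := by
        gcongr
        exact hnn.trans hnum

omit h𝒮 in
theorem good_coal {z : Platform n} (hz : Good f 𝒮 z) (he : (∅ : Finset (Fin n)) ∈ 𝒮) :
    Nset f Policy.l \ z.2.1 ∈ SA f 𝒮 ∧ z.2.1 ⊆ Nset f Policy.l := by
  rcases hz with ⟨_, _, h3, ⟨h4, h5⟩ | ⟨h4, h5⟩⟩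
  · have hs : z.2.2.2 ⊆ Nset f Policy.l := by
      intro i hi
      have := h4 hi
      rcases Nset_or hf i with h | h
      · exact h
      · simp [h] at this
    rw [h5, Finset.sdiff_sdiff_eq_self hs]
    exact ⟨Finset.mem_filter.2 ⟨h3, h4⟩, Finset.sdiff_subset⟩
  · rw [h5, Finset.sdiff_self]
    exact ⟨Finset.mem_filter.2 ⟨he, Finset.empty_subset _⟩, Finset.Subset.refl _⟩

theorem good_sum (σ : Platform n → ℝ) {S : Finset (Fin n)} (hS : S ∈ SA f 𝒮) :
    ∑ S' ∈ (SA f 𝒮).filter (fun S' => S ⊆ S'), mu f 𝒮 σ S' =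
      ∑ z ∈ univ.filter (fun z : Platform n => Good f 𝒮 z ∧ Disjoint z.2.1 S), σ z := by
  have he := h𝒮.2.2.2.2.2.2.1
  have hSl : ∀ S ∈ SA f 𝒮, S ⊆ Nset f Policy.l := by
    intro S hS
    exact (Finset.mem_filter.1 hS).2.trans (A_sub_Nl hf h𝒮)
  rw [← Finset.sum_fiberwise_of_maps_to (t := (SA f 𝒮).filter (fun S' => S ⊆ S'))
    (g := fun z : Platform n => Nset f Policy.l \ z.2.1)]
  · apply Finset.sum_congr rfl
    intro S' hS'
    rw [Finset.mem_filter] at hS'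
    unfold mu
    apply Finset.sum_congr _ (fun _ _ => rfl)
    ext z
    simp only [Finset.mem_filter, Finset.mem_univ, true_and]
    constructor
    · rintro ⟨h1, h2⟩
      refine ⟨⟨h1, ?_⟩, ?_⟩
      · rw [h2]
        exact Finset.disjoint_of_subset_right hS'.2 Finset.sdiff_disjoint
      · rw [h2, Finset.sdiff_sdiff_eq_self (hSl _ hS'.1)]
    · rintro ⟨⟨h1, h2⟩, h3⟩
      refine ⟨h1, ?_⟩
      rw [← h3, Finset.sdiff_sdiff_eq_self (good_coal hf h1 he).2]
  · intro z hz
    simp only [Finset.mem_filter, Finset.mem_univ, true_and] at hz ⊢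
    refine ⟨(good_coal hf hz.1 he).1, ?_⟩
    intro i hi
    exact Finset.mem_sdiff.2 ⟨hSl S hS hi, fun h => Finset.disjoint_left.1 hz.2 h hi⟩

theorem nu_bounds {σ : Platform n → ℝ} (h0 : ∀ z, 0 ≤ σ z) {S : Finset (Fin n)} (hS : S ∈ SA f 𝒮) :
    ∑ S' ∈ (SA f 𝒮).filter (fun S' => S ⊆ S'), mu f 𝒮 σ S' ≤ nu σ S ∧
    nu σ S ≤ ∑ S' ∈ (SA f 𝒮).filter (fun S' => S ⊆ S'), mu f 𝒮 σ S' + badm f 𝒮 σ := by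
  rw [good_sum hf h𝒮 σ hS]
  unfold nu badm
  constructor
  · apply Finset.sum_le_sum_of_subset_of_nonneg
    · intro z
      simp only [Finset.mem_filter, Finset.mem_univ, true_and]
      exact fun h => ⟨h.1.1, h.2⟩
    · intro z _ _; exact h0 z
  · rw [← Finset.sum_union]
    · apply Finset.sum_le_sum_of_subset_of_nonneg
      · intro z
        simp only [Finset.mem_filter, Finset.mem_univ, true_and, Finset.mem_union]
        tauto
      · intro z _ _; exact h0 z
    · rw [Finset.disjoint_left]
      intro z
      simp only [Finset.mem_filter, Finset.mem_univ, true_and]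
      tauto

end
end FN

namespace FN

variable {n : ℕ}

theorem sum_filter_supp {σ : Platform n → ℝ} {P Q : Platform n → Prop}
    [DecidablePred P] [DecidablePred Q]
    (h : ∀ z, σ z ≠ 0 → (P z ↔ Q z)) :
    ∑ z ∈ univ.filter P, σ z = ∑ z ∈ univ.filter Q, σ z := by
  rw [Finset.sum_filter, Finset.sum_filter]
  apply Finset.sum_congr rfl
  intro z _
  by_cases hz : σ z = 0
  · simp [hz]
  · simp [h z hz]

theorem den_split (σ : Platform n → ℝ) (a : Policy) (C : Finset (Fin n)) (S : Narrative n) :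
    den σ a C S = num σ a C S + ∑ z ∈ univ.filter (fun z : Platform n =>
      z.1 = Policy.l ∧ Agrees S a C z.1 z.2.1), σ z := by
  unfold den num
  rw [← Finset.sum_union]
  · apply Finset.sum_congr _ (fun _ _ => rfl)
    ext z
    simp only [Finset.mem_filter, Finset.mem_univ, true_and, Finset.mem_union]
    cases z.1 <;> simp
  · rw [Finset.disjoint_left]
    intro z
    simp only [Finset.mem_filter, Finset.mem_univ, true_and]
    intro h1 h2
    rw [h1.1] at h2
    cases h2.1

section
variable {f : Fin n → Policy → ℝ} (hf : FOK f) {𝒮 : Finset (Finset (Fin n))} (h𝒮 : FamilyOK f 𝒮)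
include hf h𝒮

theorem agrees_A {S : Finset (Fin n)} (hS : S ∈ SA f 𝒮) (a : Policy) (C : Finset (Fin n)) :
    Agrees (false, S) Policy.l (Nset f Policy.l \ S) a C ↔ Disjoint C S := by
  unfold Agrees
  rw [Finset.disjoint_right]
  simp only [Bool.false_eq_true, false_imp_iff, true_and, Finset.mem_sdiff]
  refine forall₂_congr fun i hi => ?_
  simp [hi]

theorem num_A {σ : Platform n → ℝ} (hσ : WOK f 𝒮 σ) {S : Finset (Fin n)} (hS : S ∈ SA f 𝒮) :
    num σ Policy.l (Nset f Policy.l \ S) (false, S) = Hm σ := by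
  unfold num Hm
  apply sum_filter_supp
  intro z hz
  rw [agrees_A hf h𝒮 hS]
  have hv : Valid f (fragFeas 𝒮) z := by
    by_contra h; exact hz (hσ.2 z h)
  constructor
  · exact fun h => h.1
  · intro h
    refine ⟨h, ?_⟩
    have h1 := adm_sub hv.1
    rw [h] at h1
    apply Finset.disjoint_of_subset_left h1
    apply Finset.disjoint_of_subset_right (Finset.mem_filter.1 hS).2
    exact Finset.disjoint_sdiff

theorem den_A {σ : Platform n → ℝ} (hσ : WOK f 𝒮 σ) {S : Finset (Fin n)} (hS : S ∈ SA f 𝒮) :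
    den σ Policy.l (Nset f Policy.l \ S) (false, S) = Hm σ + nu σ S := by
  rw [den_split, num_A hf h𝒮 hσ hS]
  unfold nu
  simp only [agrees_A hf h𝒮 hS]

theorem payoff_ge_iff {q : ℝ} (hq : 0 < q) {σ : Platform n → ℝ} (hσ : WOK f 𝒮 σ)
    {C : Finset (Fin n)} {S : Narrative n} (hC : Admissible f Policy.l C)
    (hp : q * Fval f Policy.h (Nset f Policy.h) ≤ payoff q f σ (Policy.l, C, S)) :
    Fval f Policy.h (Nset f Policy.h) * den σ Policy.l C S ≤
      num σ Policy.l C S * Fval f Policy.l C ∧ 0 < num σ Policy.l C S := by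
  have hV := Vpos hf h𝒮
  have hFC : 0 < Fval f Policy.l C := Fval_pos hC.1 (adm_sub hC)
  rw [payoff_eq, condProb_def] at hp
  simp only at hp
  have hqV := mul_pos hq hV
  have hnn := num_nonneg hσ.1 Policy.l C S
  have hnd := num_le_den hσ.1 Policy.l C S
  have hnpos : 0 < num σ Policy.l C S := by
    rcases hnn.lt_or_eq with h | h
    · exact h
    · rw [← h] at hp; simp at hp; linarith
  have hden := lt_of_lt_of_le hnpos hnd
  refine ⟨?_, hnpos⟩
  have h1 : q * (Fval f Policy.h (Nset f Policy.h) * den σ Policy.l C S) ≤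
      q * (num σ Policy.l C S * Fval f Policy.l C) := by
    have := mul_le_mul_of_nonneg_right hp hden.le
    calc _ = q * Fval f Policy.h (Nset f Policy.h) * den σ Policy.l C S := by ring
      _ ≤ _ := this
      _ = _ := by field_simp
  exact le_of_mul_le_mul_left h1 hq

theorem payoff_A_le {q : ℝ} (hq : 0 < q) {σ : Platform n → ℝ} (hσ : WOK f 𝒮 σ)
    {S : Finset (Fin n)} (hS : S ∈ SA f 𝒮) (hpos : 0 < Hm σ + nu σ S)
    (hp : payoff q f σ (Policy.l, Nset f Policy.l \ S, (false, S)) ≤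
      q * Fval f Policy.h (Nset f Policy.h)) :
    Hm σ * Fval f Policy.l (Nset f Policy.l \ S) ≤
      Fval f Policy.h (Nset f Policy.h) * (Hm σ + nu σ S) := by
  rw [payoff_eq, condProb_def] at hp
  simp only at hp
  rw [num_A hf h𝒮 hσ hS, den_A hf h𝒮 hσ hS] at hp
  have h1 : q * (Hm σ * Fval f Policy.l (Nset f Policy.l \ S)) ≤
      q * (Fval f Policy.h (Nset f Policy.h) * (Hm σ + nu σ S)) := by
    have := mul_le_mul_of_nonneg_right hp hpos.le
    calc _ = q * Hm σ / (Hm σ + nu σ S) * Fval f Policy.l (Nset f Policy.l \ S) * (Hm σ + nu σ S) := by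
          field_simp
      _ ≤ _ := this
      _ = _ := by ring
  exact le_of_mul_le_mul_left h1 hq

theorem badm_nonneg {σ : Platform n → ℝ} (hσ : WOK f 𝒮 σ) : 0 ≤ badm f 𝒮 σ :=
  Finset.sum_nonneg fun z _ => hσ.1 z

theorem Hm_nonneg {σ : Platform n → ℝ} (hσ : WOK f 𝒮 σ) : 0 ≤ Hm σ :=
  Finset.sum_nonneg fun z _ => hσ.1 z

theorem nu_nonneg {σ : Platform n → ℝ} (hσ : WOK f 𝒮 σ) (S : Finset (Fin n)) : 0 ≤ nu σ S :=
  Finset.sum_nonneg fun z _ => hσ.1 z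

theorem mu_nonneg {σ : Platform n → ℝ} (hσ : WOK f 𝒮 σ) (S : Finset (Fin n)) : 0 ≤ mu f 𝒮 σ S :=
  Finset.sum_nonneg fun z _ => hσ.1 z

theorem good_ineq {q : ℝ} (hq : 0 < q) {σ : Platform n → ℝ} (hσ : WOK f 𝒮 σ)
    {z : Platform n} (hz : Good f 𝒮 z) {S : Finset (Fin n)} (hS : S ∈ SA f 𝒮)
    (hzS : z.2.1 = Nset f Policy.l \ S)
    (hp : q * Fval f Policy.h (Nset f Policy.h) ≤ payoff q f σ z) :
    Fval f Policy.h (Nset f Policy.h) * (Hm σ + nu σ S - badm f 𝒮 σ) ≤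
      Hm σ * Fval f Policy.l (Nset f Policy.l \ S) := by
  have hV := Vpos hf h𝒮
  have hSl : S ⊆ Nset f Policy.l := (Finset.mem_filter.1 hS).2.trans (A_sub_Nl hf h𝒮)
  have hadm := (valid_A hf h𝒮 hS).1
  simp only at hadm
  have hb := badm_nonneg hf h𝒮 hσ
  obtain ⟨a, C, b, S'⟩ := z
  obtain ⟨h1, h2, h3, h4⟩ := hz
  simp only at h1 h2 h3 h4 hzS
  subst h1 h2 hzS
  have key := payoff_ge_iff hf h𝒮 hq hσ hadm hp
  rcases h4 with ⟨h4, h5⟩ | ⟨h4, h5⟩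
  · have e : S' = S := by
      have h6 : S' ⊆ Nset f Policy.l := h4.trans (A_sub_Nl hf h𝒮)
      rw [← Finset.sdiff_sdiff_eq_self hSl, h5, Finset.sdiff_sdiff_eq_self h6]
    subst e
    rw [num_A hf h𝒮 hσ hS, den_A hf h𝒮 hσ hS] at key
    nlinarith [key.1, mul_nonneg hV.le hb]
  · have hSe : S = ∅ := by
      rw [← Finset.sdiff_sdiff_eq_self hSl, h5, Finset.sdiff_self]
    subst hSe
    have hle : num σ Policy.l (Nset f Policy.l \ ∅) (false, S') ≤ Hm σ := by
      apply Finset.sum_le_sum_of_subset_of_nonneg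
      · intro z
        simp only [Finset.mem_filter]; tauto
      · intro z _ _; exact hσ.1 z
    have hnu : nu σ ∅ ≤ ∑ z ∈ univ.filter (fun z : Platform n =>
      z.1 = Policy.l ∧ Agrees (false, S') Policy.l (Nset f Policy.l \ ∅) z.1 z.2.1), σ z
        + badm f 𝒮 σ := by
      unfold nu badm
      rw [← Finset.sum_union_inter]
      refine le_trans ?_ (le_add_of_nonneg_right (Finset.sum_nonneg fun z _ => hσ.1 z))
      apply Finset.sum_le_sum_of_subset_of_nonneg
      · intro z
        simp only [Finset.mem_filter, Finset.mem_univ, true_and, Finset.mem_union]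
        rintro ⟨hz1, _⟩
        by_cases hg : Good f 𝒮 z
        · left
          refine ⟨hz1, by simp, ?_⟩
          intro i hi
          have hi := h4 hi
          have : i ∈ z.2.1 := by
            rcases hg with ⟨_, _, _, ⟨h7, h8⟩ | ⟨h7, h8⟩⟩
            · rw [h8]; exact M_sub hf h𝒮 h7 hi
            · rw [h8]; exact (Finset.mem_inter.1 hi).1
          simp [this, (Finset.mem_inter.1 hi).1]
        · exact Or.inr ⟨hz1, hg⟩
      · intro z _ _; exact hσ.1 z
    rw [den_split] at key
    set X := ∑ z ∈ univ.filter (fun z : Platform n =>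
      z.1 = Policy.l ∧ Agrees (false, S') Policy.l (Nset f Policy.l \ ∅) z.1 z.2.1), σ z with hX
    set m := num σ Policy.l (Nset f Policy.l \ ∅) (false, S') with hm
    set V := Fval f Policy.h (Nset f Policy.h)
    set F := Fval f Policy.l (Nset f Policy.l \ ∅)
    have hX0 : 0 ≤ X := Finset.sum_nonneg fun z _ => hσ.1 z
    obtain ⟨k1, k2⟩ := key
    have hFV : V ≤ F := by
      have : m * V ≤ m * F := by nlinarith [mul_nonneg hV.le hX0]
      exact le_of_mul_le_mul_left this k2
    have e1 : V * (nu σ ∅ - badm f 𝒮 σ) ≤ V * X := by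
      apply mul_le_mul_of_nonneg_left _ hV.le; linarith
    have e2 : m * (F - V) ≤ Hm σ * (F - V) := by
      apply mul_le_mul_of_nonneg_right hle; linarith
    nlinarith

/-- Consequences of being an equilibrium. -/
theorem equil {q : ℝ} (hq : 0 < q) {σ : Platform n → ℝ}
    (hE : Equilibrium q f (fragFeas 𝒮) σ) :
    WOK f 𝒮 σ ∧ ∑ z, σ z = 1 ∧ hoff f σ = 0 ∧ badm f 𝒮 σ = 0 ∧ 0 < Hm σ ∧
    ∀ S ∈ SA f 𝒮, Hm σ * Fval f Policy.l (Nset f Policy.l \ S) ≤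
        Fval f Policy.h (Nset f Policy.h) * (Hm σ + nu σ S) ∧
      (0 < mu f 𝒮 σ S → Fval f Policy.h (Nset f Policy.h) * (Hm σ + nu σ S) ≤
        Hm σ * Fval f Policy.l (Nset f Policy.l \ S)) := by
  obtain ⟨ε, σk, hε0, hε, heq, hlim⟩ := hE
  have hV := Vpos hf h𝒮
  set V := Fval f Policy.h (Nset f Policy.h) with hVdef
  have h0 : ∀ z, 0 ≤ σ z := fun z => ge_of_tendsto' (hlim z) (fun k => (heq k).1.1 z)
  have hinv : ∀ z, ¬ Valid f (fragFeas 𝒮) z → σ z = 0 := by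
    intro z hz
    have : ∀ k, σk k z = 0 := fun k =>
      le_antisymm (not_lt.1 fun h => hz (((heq k).2.1 z).1 h)) ((heq k).1.1 z)
    exact tendsto_nhds_unique (hlim z) (by simp [this])
  have hσ : WOK f 𝒮 σ := ⟨h0, hinv⟩
  have hsum : ∑ z, σ z = 1 := by
    refine tendsto_nhds_unique (tendsto_finsetSum univ fun z _ => hlim z) ?_
    simp [(heq _).1.2]
  have hvalid : ∀ z, 0 < σ z → Valid f (fragFeas 𝒮) z := by
    intro z hz; by_contra h; rw [hinv z h] at hz; exact lt_irrefl _ hz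
  have hcont : ∀ z : Platform n, den σ z.1 z.2.1 z.2.2 ≠ 0 →
      Filter.Tendsto (fun k => payoff q f (σk k) z) Filter.atTop (nhds (payoff q f σ z)) := by
    intro z hz
    simp only [payoff_eq, condProb_def]
    refine Filter.Tendsto.mul_const _ (Filter.Tendsto.div ?_ ?_ hz)
    · exact (tendsto_finsetSum _ fun z _ => hlim z).const_mul q
    · exact tendsto_finsetSum _ fun z _ => hlim z
  have hev : ∀ z, 0 < σ z → ∀ᶠ k in Filter.atTop, ∀ z', Valid f (fragFeas 𝒮) z' →
      payoff q f (σk k) z' ≤ payoff q f (σk k) z := by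
    intro z hz
    have : ∀ᶠ k in Filter.atTop, ε k < σk k z := hε.eventually_lt (hlim z) hz
    filter_upwards [this] with k hk
    exact (heq k).2.2 z (hvalid z hz) hk
  have hdpos : ∀ z, 0 < σ z → 0 < den σ z.1 z.2.1 z.2.2 := fun z hz =>
    lt_of_lt_of_le hz (le_den h0 z)
  have E1 : ∀ z, 0 < σ z → q * V ≤ payoff q f σ z := by
    intro z hz
    refine ge_of_tendsto (hcont z (hdpos z hz).ne') ?_
    filter_upwards [hev z hz] with k hk
    refine le_trans (le_of_eq ?_) (hk _ (valid_true hf h𝒮))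
    rw [payoff_eq]
    simp only
    rw [condProb_true (heq k).1.1 (((heq k).2.1 _).2 (valid_true hf h𝒮))]
  obtain ⟨z1, -, hz1⟩ : ∃ z ∈ (univ : Finset (Platform n)), 0 < σ z := by
    exact Finset.exists_lt_of_sum_lt (f := fun _ => (0:ℝ)) (by simp [hsum])
  have hHex : ∃ z, 0 < σ z ∧ z.1 = Policy.h := by
    rcases h : z1.1 with _ | _
    · obtain ⟨a, C, S⟩ := z1
      simp only at h
      subst h
      have := (payoff_ge_iff hf h𝒮 hq hσ (hvalid _ hz1).1 (E1 _ hz1)).2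
      obtain ⟨z, hz, hzp⟩ := Finset.exists_lt_of_sum_lt (s := univ.filter (fun z : Platform n =>
        z.1 = Policy.h ∧ Agrees S Policy.l C z.1 z.2.1)) (f := fun _ => (0:ℝ)) (g := σ)
        (by simpa [num] using this)
      exact ⟨z, hzp, (Finset.mem_filter.1 hz).2.1⟩
    · exact ⟨z1, hz1, h⟩
  obtain ⟨z0, hz0, hz0h⟩ := hHex
  have hHpos : 0 < Hm σ := lt_of_lt_of_le hz0
    (Finset.single_le_sum (f := σ) (fun z _ => h0 z) (by simp [hz0h]))
  have hhle : ∀ (τ : Platform n → ℝ) (z : Platform n), (∀ z, 0 ≤ τ z) →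
      Valid f (fragFeas 𝒮) z → z.1 = Policy.h → payoff q f τ z ≤ q * V := by
    intro τ z hτ hv hh
    rw [payoff_eq]
    have h1 := adm_sub hv.1
    have h2 := condProb_le hτ hq z.1 z.2.1 z.2.2
    rw [hh] at h1 h2 ⊢
    exact mul_le_mul h2 (Fval_mono hf h1) (Finset.sum_nonneg fun i _ => hf.1 i _) hq.le
  have E2 : ∀ z : Platform n, Valid f (fragFeas 𝒮) z → den σ z.1 z.2.1 z.2.2 ≠ 0 →
      payoff q f σ z ≤ q * V := by
    intro z hv hd
    refine le_of_tendsto (hcont z hd) ?_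
    filter_upwards [hev z0 hz0] with k hk
    exact (hk z hv).trans (hhle _ _ (heq k).1.1 (hvalid z0 hz0) hz0h)
  have hhoff : hoff f σ = 0 := by
    apply Finset.sum_eq_zero
    intro z hz
    simp only [Finset.mem_filter, Finset.mem_univ, true_and] at hz
    by_contra hne
    have hpos : 0 < σ z := lt_of_le_of_ne (h0 z) (Ne.symm hne)
    have h1 := E1 z hpos
    have hs := adm_sub (hvalid z hpos).1
    have h2 := condProb_le h0 hq z.1 z.2.1 z.2.2
    rw [payoff_eq] at h1
    rw [hz.1] at h1 h2 hs
    apply hz.2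
    apply Fval_eq_of_le hs (Finset.Subset.refl _)
    have h3 : 0 ≤ Fval f Policy.h z.2.1 := Finset.sum_nonneg fun i _ => hf.1 i _
    have h4 := mul_le_mul_of_nonneg_right h2 h3
    exact le_of_mul_le_mul_left (h1.trans h4) hq
  have hbad : badm f 𝒮 σ = 0 := by
    apply Finset.sum_eq_zero
    intro z hz
    simp only [Finset.mem_filter, Finset.mem_univ, true_and] at hz
    by_contra hne
    have hpos : 0 < σ z := lt_of_le_of_ne (h0 z) (Ne.symm hne)
    obtain ⟨a, C, S⟩ := z
    obtain ⟨h1, h2⟩ := hz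
    simp only at h1
    subst h1
    have hnum := (payoff_ge_iff hf h𝒮 hq hσ (hvalid _ hpos).1 (E1 _ hpos)).2
    have hcp : 0 < condProb q σ Policy.l C S := by
      rw [condProb_def]
      exact div_pos (mul_pos hq hnum) (hdpos _ hpos)
    rcases classify hf h𝒮 hq hσ (hvalid _ hpos) (E1 _ hpos) (by
      intro C' hC' e
      refine le_trans (E2 _ ⟨hC', (hvalid _ hpos).2⟩ ?_) (E1 _ hpos)
      intro hd
      simp only at hd
      rw [← e, condProb_def, hd] at hcp
      simp at hcp) with h | h
    · exact h2 h
    · rw [hhoff, zero_mul] at h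
      have := mul_pos hpos hV
      linarith
  refine ⟨hσ, hsum, hhoff, hbad, hHpos, fun S hS => ⟨?_, fun hmu => ?_⟩⟩
  · have hp : 0 < Hm σ + nu σ S := add_pos_of_pos_of_nonneg hHpos (nu_nonneg hf h𝒮 hσ S)
    apply payoff_A_le hf h𝒮 hq hσ hS hp
    apply E2 _ (valid_A hf h𝒮 hS)
    simp only
    rw [den_A hf h𝒮 hσ hS]
    exact hp.ne'
  · obtain ⟨z, hz, hzp⟩ := Finset.exists_lt_of_sum_lt (s := univ.filter (fun z : Platform n =>
        Good f 𝒮 z ∧ z.2.1 = Nset f Policy.l \ S)) (f := fun _ => (0:ℝ)) (g := σ)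
        (by simpa [mu] using hmu)
    simp only [Finset.mem_filter, Finset.mem_univ, true_and] at hz
    have := good_ineq hf h𝒮 hq hσ hz.1 hS hz.2 (E1 z hzp)
    rwa [hbad, sub_zero] at this

end
end FN

namespace FN

variable {n : ℕ}

theorem step_sum {w w' : Platform n → ℝ} {y : Platform n}
    (h : ∀ z, w' z = w z + if z = y then 1 else 0) (P : Platform n → Prop) [DecidablePred P] :
    ∑ z ∈ univ.filter P, w' z = ∑ z ∈ univ.filter P, w z + if P y then 1 else 0 := by
  simp only [h, Finset.sum_add_distrib, Finset.sum_ite_eq', Finset.mem_filter, Finset.mem_univ,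
    true_and]

section
variable {f : Fin n → Policy → ℝ} (hf : FOK f) {𝒮 : Finset (Finset (Fin n))} (h𝒮 : FamilyOK f 𝒮)
  {q : ℝ} (hq : 0 < q) {w : ℕ → Platform n → ℝ} {y : ℕ → Platform n}
  (hw0 : ∀ z, 0 ≤ w 0 z) (hws : ∑ z, w 0 z = 1)
  (hfull : ∀ z, 0 < w 0 z ↔ Valid f (fragFeas 𝒮) z)
  (hmax : ∀ k, Valid f (fragFeas 𝒮) (y k) ∧ ∀ z, Valid f (fragFeas 𝒮) z →
    payoff q f (w k) z ≤ payoff q f (w k) (y k))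
  (hstep : ∀ k z, w (k + 1) z = w k z + if z = y k then 1 else 0)
include hf h𝒮 hq hw0 hws hfull hmax hstep

theorem dyn_ok (k : ℕ) : WOK f 𝒮 (w k) ∧ ∀ z, Valid f (fragFeas 𝒮) z → 0 < w k z := by
  induction k with
  | zero =>
    refine ⟨⟨hw0, fun z hz => ?_⟩, fun z hz => (hfull z).2 hz⟩
    exact le_antisymm (not_lt.1 fun h => hz ((hfull z).1 h)) (hw0 z)
  | succ k ih =>
    refine ⟨⟨fun z => ?_, fun z hz => ?_⟩, fun z hz => ?_⟩
    · rw [hstep]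
      have := ih.1.1 z
      split_ifs <;> linarith
    · rw [hstep, ih.1.2 z hz, if_neg]
      · simp
      · rintro rfl; exact hz (hmax k).1
    · rw [hstep]
      have := ih.2 z hz
      split_ifs <;> linarith

theorem dyn_ge (k : ℕ) : q * Fval f Policy.h (Nset f Policy.h) ≤ payoff q f (w k) (y k) := by
  have hok := dyn_ok hf h𝒮 hq hw0 hws hfull hmax hstep k
  refine le_trans (le_of_eq ?_) ((hmax k).2 _ (valid_true hf h𝒮))
  rw [payoff_eq]
  simp only
  rw [condProb_true hok.1.1 (hok.2 _ (valid_true hf h𝒮))]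

theorem dyn_h (k : ℕ) (hk : (y k).1 = Policy.h) : (y k).2.1 = Nset f Policy.h ∧
    payoff q f (w k) (y k) ≤ q * Fval f Policy.h (Nset f Policy.h) := by
  have hok := dyn_ok hf h𝒮 hq hw0 hws hfull hmax hstep k
  have h1 := dyn_ge hf h𝒮 hq hw0 hws hfull hmax hstep k
  have h2 := condProb_le hok.1.1 hq (y k).1 (y k).2.1 (y k).2.2
  have hs := adm_sub (hmax k).1.1
  rw [payoff_eq] at h1 ⊢
  rw [hk] at h1 h2 hs ⊢
  have h3 : 0 ≤ Fval f Policy.h (y k).2.1 := Finset.sum_nonneg fun i _ => hf.1 i _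
  have h4 := mul_le_mul_of_nonneg_right h2 h3
  have h5 := Fval_mono hf (a := Policy.h) hs
  refine ⟨Fval_eq_of_le hs (Finset.Subset.refl _) (le_of_mul_le_mul_left (h1.trans h4) hq), ?_⟩
  exact h4.trans (mul_le_mul_of_nonneg_left h5 hq.le)

theorem part_le_one (P : Platform n → Prop) [DecidablePred P] :
    ∑ z ∈ univ.filter P, w 0 z ≤ 1 := by
  rw [← hws]
  exact Finset.sum_le_sum_of_subset_of_nonneg (Finset.filter_subset _ _) fun z _ _ => hw0 z

theorem dyn_hoff (k : ℕ) : hoff f (w k) ≤ 1 := by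
  induction k with
  | zero => exact part_le_one hf h𝒮 hq hw0 hws hfull hmax hstep _
  | succ k ih =>
    unfold hoff at ih ⊢
    rw [step_sum (hstep k), if_neg, add_zero]
    · exact ih
    · rintro ⟨h1, h2⟩
      exact h2 (dyn_h hf h𝒮 hq hw0 hws hfull hmax hstep k h1).1

theorem dyn_badz (z : Platform n) (hz : z.1 = Policy.l) (hb : ¬ Good f 𝒮 z) (k : ℕ) :
    w k z ≤ Fval f Policy.l (Nset f Policy.l) / Fval f Policy.h (Nset f Policy.h) + 1 := by
  have hV := Vpos hf h𝒮
  have hF : 0 ≤ Fval f Policy.l (Nset f Policy.l) := Finset.sum_nonneg fun i _ => hf.1 i _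
  have hK : 0 ≤ Fval f Policy.l (Nset f Policy.l) / Fval f Policy.h (Nset f Policy.h) :=
    div_nonneg hF hV.le
  induction k with
  | zero =>
    have : w 0 z ≤ 1 := by
      rw [← hws]; exact Finset.single_le_sum (f := w 0) (fun z _ => hw0 z) (mem_univ z)
    linarith
  | succ k ih =>
    rw [hstep]
    split_ifs with h
    · have hok := dyn_ok hf h𝒮 hq hw0 hws hfull hmax hstep k
      have hge := dyn_ge hf h𝒮 hq hw0 hws hfull hmax hstep k
      have hmk := hmax k
      have hho := dyn_hoff hf h𝒮 hq hw0 hws hfull hmax hstep k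
      rw [← h] at hge hmk
      obtain ⟨a, C, S⟩ := z
      simp only at hz
      subst hz
      rcases classify hf h𝒮 hq hok.1 hmk.1 hge
        (fun C' hC' _ => hmk.2 _ ⟨hC', hmk.1.2⟩) with h | h
      · exact absurd h hb
      · have : w k (Policy.l, C, S) ≤
            Fval f Policy.l (Nset f Policy.l) / Fval f Policy.h (Nset f Policy.h) := by
          rw [le_div_iff₀ hV]
          refine h.trans ?_
          have := mul_le_mul_of_nonneg_right hho hF
          linarith
        linarith
    · linarith

theorem dyn_bad : ∃ c : ℝ, ∀ k, badm f 𝒮 (w k) ≤ c := by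
  refine ⟨∑ z ∈ univ.filter (fun z : Platform n => z.1 = Policy.l ∧ ¬ Good f 𝒮 z),
    (Fval f Policy.l (Nset f Policy.l) / Fval f Policy.h (Nset f Policy.h) + 1), fun k => ?_⟩
  apply Finset.sum_le_sum
  intro z hz
  simp only [Finset.mem_filter, Finset.mem_univ, true_and] at hz
  exact dyn_badz hf h𝒮 hq hw0 hws hfull hmax hstep z hz.1 hz.2 k

theorem Hm_step (k : ℕ) : Hm (w (k+1)) = Hm (w k) + if (y k).1 = Policy.h then 1 else 0 := by
  unfold Hm; rw [step_sum (hstep k)]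

theorem dyn_gap {S : Finset (Fin n)} (hS : S ∈ SA f 𝒮) (k : ℕ) :
    Hm (w k) * (Fval f Policy.l (Nset f Policy.l \ S) - Fval f Policy.h (Nset f Policy.h)) -
      Fval f Policy.h (Nset f Policy.h) * nu (w k) S ≤
    |Fval f Policy.l (Nset f Policy.l \ S) - Fval f Policy.h (Nset f Policy.h)| := by
  have hV := Vpos hf h𝒮
  induction k with
  | zero =>
    have hok := dyn_ok hf h𝒮 hq hw0 hws hfull hmax hstep 0
    have h1 := Hm_nonneg hf h𝒮 hok.1
    have h2 : Hm (w 0) ≤ 1 := part_le_one hf h𝒮 hq hw0 hws hfull hmax hstep _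
    have h3 := mul_nonneg hV.le (nu_nonneg hf h𝒮 hok.1 S)
    have h4 := le_abs_self (Fval f Policy.l (Nset f Policy.l \ S) - Fval f Policy.h (Nset f Policy.h))
    have h5 := abs_nonneg (Fval f Policy.l (Nset f Policy.l \ S) - Fval f Policy.h (Nset f Policy.h))
    nlinarith
  | succ k ih =>
    have hok := dyn_ok hf h𝒮 hq hw0 hws hfull hmax hstep k
    have hH := Hm_step hf h𝒮 hq hw0 hws hfull hmax hstep k
    have hnu : nu (w (k+1)) S = nu (w k) S +
        if ((y k).1 = Policy.l ∧ Disjoint (y k).2.1 S) then 1 else 0 := by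
      unfold nu; rw [step_sum (hstep k)]
    rw [hH, hnu]
    by_cases hh : (y k).1 = Policy.h
    · have hpos : 0 < Hm (w k) + nu (w k) S := by
        have : 0 < Hm (w k) := lt_of_lt_of_le (hok.2 _ (valid_true hf h𝒮))
          (Finset.single_le_sum (f := w k) (fun z _ => hok.1.1 z) (by simp))
        linarith [nu_nonneg hf h𝒮 hok.1 S]
      have h1 := payoff_A_le hf h𝒮 hq hok.1 hS hpos
        (((hmax k).2 _ (valid_A hf h𝒮 hS)).trans (dyn_h hf h𝒮 hq hw0 hws hfull hmax hstep k hh).2)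
      rw [if_pos hh, if_neg (by rw [hh]; simp)]
      have h4 := le_abs_self (Fval f Policy.l (Nset f Policy.l \ S) - Fval f Policy.h (Nset f Policy.h))
      nlinarith
    · rw [if_neg hh, add_zero]
      refine le_trans ?_ ih
      split_ifs
      · nlinarith
      · simp

theorem dyn_mu {m : Finset (Fin n) → ℝ} (hm0 : ∀ S, 0 ≤ m S)
    (hm1 : ∀ S ∈ SA f 𝒮, Fval f Policy.l (Nset f Policy.l \ S) - Fval f Policy.h (Nset f Policy.h) ≤
      Fval f Policy.h (Nset f Policy.h) * ∑ S' ∈ (SA f 𝒮).filter (fun S' => S ⊆ S'), m S')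
    (hm2 : ∀ S ∈ SA f 𝒮, 0 < m S →
      Fval f Policy.h (Nset f Policy.h) * ∑ S' ∈ (SA f 𝒮).filter (fun S' => S ⊆ S'), m S' ≤
      Fval f Policy.l (Nset f Policy.l \ S) - Fval f Policy.h (Nset f Policy.h))
    (S : Finset (Fin n)) : S ∈ SA f 𝒮 →
    ∃ c : ℝ, ∀ k, |mu f 𝒮 (w k) S - Hm (w k) * m S| ≤ c := by
  have hV := Vpos hf h𝒮
  obtain ⟨cb, hcb⟩ := dyn_bad hf h𝒮 hq hw0 hws hfull hmax hstep
  induction S using WellFoundedGT.induction with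
  | ind S ih =>
  intro hS
  set V := Fval f Policy.h (Nset f Policy.h) with hVd
  set F := Fval f Policy.l (Nset f Policy.l \ S) with hFd
  have hch : ∀ S' : Finset (Fin n), ∃ c : ℝ, (S < S' → S' ∈ SA f 𝒮 →
      ∀ k, |mu f 𝒮 (w k) S' - Hm (w k) * m S'| ≤ c) := by
    intro S'
    by_cases h : S < S' ∧ S' ∈ SA f 𝒮
    · obtain ⟨c, hc⟩ := ih S' h.1 h.2
      exact ⟨c, fun _ _ => hc⟩
    · exact ⟨0, fun h1 h2 => absurd ⟨h1, h2⟩ h⟩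
  choose c hc using hch
  have hsplit : (SA f 𝒮).filter (fun S' => S ⊆ S') =
      insert S ((SA f 𝒮).filter (fun S' => S ⊂ S')) := by
    ext T
    simp only [Finset.mem_filter, Finset.mem_insert]
    constructor
    · rintro ⟨h1, h2⟩
      rcases eq_or_ssubset_of_subset h2 with h | h
      · exact Or.inl h.symm
      · exact Or.inr ⟨h1, h⟩
    · rintro (rfl | h)
      · exact ⟨hS, Finset.Subset.refl _⟩
      · exact ⟨h.1, h.2.subset⟩
  have hnot : S ∉ (SA f 𝒮).filter (fun S' => S ⊂ S') := by simp
  set c1 := ∑ S' ∈ (SA f 𝒮).filter (fun S' => S ⊂ S'), c S' with hc1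
  set r := ∑ S' ∈ (SA f 𝒮).filter (fun S' => S ⊂ S'), m S' with hr
  have hR : ∀ k, |∑ S' ∈ (SA f 𝒮).filter (fun S' => S ⊂ S'), mu f 𝒮 (w k) S' - Hm (w k) * r| ≤ c1 := by
    intro k
    rw [hr, Finset.mul_sum, ← Finset.sum_sub_distrib]
    refine (Finset.abs_sum_le_sum_abs _ _).trans (Finset.sum_le_sum fun T hT => ?_)
    rw [Finset.mem_filter] at hT
    exact hc T hT.2 hT.1 k
  have hm1S := hm1 S hS
  have hm2S := hm2 S hS
  rw [hsplit, Finset.sum_insert hnot] at hm1S hm2S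
  rw [← hr] at hm1S hm2S
  have hc1n : 0 ≤ c1 := (abs_nonneg _).trans (hR 0)
  have hcbn : 0 ≤ cb := (badm_nonneg hf h𝒮
    (dyn_ok hf h𝒮 hq hw0 hws hfull hmax hstep 0).1).trans (hcb 0)
  have hmun : ∀ k, 0 ≤ mu f 𝒮 (w k) S := fun k =>
    mu_nonneg hf h𝒮 (dyn_ok hf h𝒮 hq hw0 hws hfull hmax hstep k).1 S
  have hHn : ∀ k, 0 ≤ Hm (w k) := fun k =>
    Hm_nonneg hf h𝒮 (dyn_ok hf h𝒮 hq hw0 hws hfull hmax hstep k).1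
  have hupper : ∀ k, mu f 𝒮 (w k) S ≤ Hm (w k) * m S + (c1 + cb + 1) := by
    intro k
    induction k with
    | zero =>
      have h1 : mu f 𝒮 (w 0) S ≤ 1 := part_le_one hf h𝒮 hq hw0 hws hfull hmax hstep _
      have h2 := mul_nonneg (hHn 0) (hm0 S)
      linarith
    | succ k ihk =>
      have hok := dyn_ok hf h𝒮 hq hw0 hws hfull hmax hstep k
      have hH := Hm_step hf h𝒮 hq hw0 hws hfull hmax hstep k
      have hmono : Hm (w k) * m S ≤ Hm (w (k+1)) * m S := by
        apply mul_le_mul_of_nonneg_right _ (hm0 S)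
        rw [hH]; split_ifs <;> linarith
      have hmu : mu f 𝒮 (w (k+1)) S = mu f 𝒮 (w k) S +
          if (Good f 𝒮 (y k) ∧ (y k).2.1 = Nset f Policy.l \ S) then 1 else 0 := by
        unfold mu; rw [step_sum (hstep k)]
      rw [hmu]
      split_ifs with hg
      · have h1 := good_ineq hf h𝒮 hq hok.1 hg.1 hS hg.2
          (dyn_ge hf h𝒮 hq hw0 hws hfull hmax hstep k)
        rw [← hVd, ← hFd] at h1
        have h2 := (nu_bounds hf h𝒮 hok.1.1 hS).1
        rw [hsplit, Finset.sum_insert hnot] at h2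
        have h3 := (abs_le.1 (hR k)).1
        have h4 := hcb k
        have h5 : Hm (w k) * (F - V) ≤ Hm (w k) * (V * (m S + r)) :=
          mul_le_mul_of_nonneg_left hm1S (hHn k)
        have h6 : V * (nu (w k) S - badm f 𝒮 (w k)) ≤ V * (Hm (w k) * (m S + r)) := by
          nlinarith
        have h7 := le_of_mul_le_mul_left h6 hV
        linarith
      · linarith
  refine ⟨c1 + cb + 1 + |F - V| / V, fun k => ?_⟩
  have hd : 0 ≤ |F - V| / V := div_nonneg (abs_nonneg _) hV.le
  rw [abs_le]
  refine ⟨?_, by linarith [hupper k]⟩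
  rcases (hm0 S).lt_or_eq with hpos | hz
  · have hok := dyn_ok hf h𝒮 hq hw0 hws hfull hmax hstep k
    have h1 := dyn_gap hf h𝒮 hq hw0 hws hfull hmax hstep hS k
    rw [← hVd, ← hFd] at h1
    have h2 := (nu_bounds hf h𝒮 hok.1.1 hS).2
    rw [hsplit, Finset.sum_insert hnot] at h2
    have h3 := (abs_le.1 (hR k)).2
    have h4 := hcb k
    have h5 : Hm (w k) * (V * (m S + r)) ≤ Hm (w k) * (F - V) :=
      mul_le_mul_of_nonneg_left (hm2S hpos) (hHn k)
    have h6 : V * (Hm (w k) * (m S + r) - nu (w k) S) ≤ |F - V| := by nlinarith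
    have h7 : Hm (w k) * (m S + r) - nu (w k) S ≤ |F - V| / V := by
      rw [le_div_iff₀ hV]; linarith
    linarith
  · rw [← hz, mul_zero]
    linarith [hmun k]

end
end FN

namespace FN

variable {n : ℕ}

theorem lim_zero {x : ℕ → ℝ} {φ : ℕ → ℕ} (hφ : StrictMono φ) {L c : ℝ}
    (hx : Filter.Tendsto x Filter.atTop (nhds L))
    (hb : ∀ k, 1 ≤ φ k → |(φ k : ℝ) * x k| ≤ c) : L = 0 := by
  have hφt : Filter.Tendsto (fun k => (φ k : ℝ)) Filter.atTop Filter.atTop :=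
    tendsto_natCast_atTop_atTop.comp hφ.tendsto_atTop
  have h2 : Filter.Tendsto (fun k => c / (φ k : ℝ)) Filter.atTop (nhds 0) :=
    hφt.const_div_atTop c
  have h3 : Filter.Tendsto x Filter.atTop (nhds 0) := by
    apply squeeze_zero_norm' _ h2
    filter_upwards [Filter.eventually_ge_atTop 1] with k hk
    have h1 : 1 ≤ φ k := hk.trans (hφ.id_le k)
    have hp : (0:ℝ) < φ k := by exact_mod_cast h1
    rw [Real.norm_eq_abs, le_div_iff₀ hp]
    have := hb k h1
    rw [abs_mul, abs_of_pos hp] at this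
    linarith
  exact tendsto_nhds_unique hx h3

theorem marg_eq (σ : Platform n → ℝ) (a : Policy) (C : Finset (Fin n)) :
    ∑ S : Narrative n, σ (a, C, S) =
      ∑ z ∈ univ.filter (fun z : Platform n => z.1 = a ∧ z.2.1 = C), σ z := by
  apply Finset.sum_nbij' (i := fun N => (a, C, N)) (j := fun z => z.2.2)
  · intro N _; simp
  · intro z _; simp
  · intro N _; rfl
  · rintro ⟨a', C', N⟩ hz
    simp only [Finset.mem_filter, Finset.mem_univ, true_and] at hz
    rw [hz.1, hz.2]
  · intro N _; rfl

section
variable {f : Fin n → Policy → ℝ} (hf : FOK f) {𝒮 : Finset (Finset (Fin n))} (h𝒮 : FamilyOK f 𝒮)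
include hf h𝒮

theorem marg_h {σ : Platform n → ℝ} (hσ : WOK f 𝒮 σ) (hh : hoff f σ = 0) (C : Finset (Fin n)) :
    ∑ S : Narrative n, σ (Policy.h, C, S) = if C = Nset f Policy.h then Hm σ else 0 := by
  have hz : ∀ z : Platform n, z.1 = Policy.h ∧ z.2.1 ≠ Nset f Policy.h → σ z = 0 := by
    intro z hz
    exact (Finset.sum_eq_zero_iff_of_nonneg (fun z _ => hσ.1 z)).1 hh z (by simpa using hz)
  rw [marg_eq]
  split_ifs with h
  · subst h
    apply sum_filter_supp
    intro z hne
    constructor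
    · exact fun h => h.1
    · intro h
      refine ⟨h, ?_⟩
      by_contra h'
      exact hne (hz z ⟨h, h'⟩)
  · apply Finset.sum_eq_zero
    intro z hzz
    simp only [Finset.mem_filter, Finset.mem_univ, true_and] at hzz
    exact hz z ⟨hzz.1, by rw [hzz.2]; exact h⟩

theorem bad_zero {σ : Platform n → ℝ} (hσ : WOK f 𝒮 σ) (hb : badm f 𝒮 σ = 0) (z : Platform n)
    (hz : z.1 = Policy.l) (hne : σ z ≠ 0) : Good f 𝒮 z := by
  by_contra hg
  exact hne ((Finset.sum_eq_zero_iff_of_nonneg (fun z _ => hσ.1 z)).1 hb z (by simp [hz, hg]))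

theorem marg_l {σ : Platform n → ℝ} (hσ : WOK f 𝒮 σ) (hb : badm f 𝒮 σ = 0) (C : Finset (Fin n)) :
    ∑ S : Narrative n, σ (Policy.l, C, S) =
      if Nset f Policy.l \ C ∈ SA f 𝒮 ∧ C ⊆ Nset f Policy.l then
        mu f 𝒮 σ (Nset f Policy.l \ C) else 0 := by
  rw [marg_eq]
  split_ifs with h
  · unfold mu
    apply sum_filter_supp
    intro z hne
    rw [Finset.sdiff_sdiff_eq_self h.2]
    constructor
    · exact fun h => ⟨bad_zero hf h𝒮 hσ hb z h.1 hne, h.2⟩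
    · exact fun h => ⟨h.1.1, h.2⟩
  · apply Finset.sum_eq_zero
    intro z hzz
    simp only [Finset.mem_filter, Finset.mem_univ, true_and] at hzz
    by_contra hne
    have := good_coal hf (bad_zero hf h𝒮 hσ hb z hzz.1 hne) h𝒮.2.2.2.2.2.2.1
    rw [hzz.2] at this
    exact h this

theorem nu_eq {σ : Platform n → ℝ} (hσ : WOK f 𝒮 σ) (hb : badm f 𝒮 σ = 0)
    {S : Finset (Fin n)} (hS : S ∈ SA f 𝒮) :
    nu σ S = ∑ S' ∈ (SA f 𝒮).filter (fun S' => S ⊆ S'), mu f 𝒮 σ S' := by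
  have := nu_bounds hf h𝒮 hσ.1 hS
  rw [hb, add_zero] at this
  exact le_antisymm this.2 this.1

theorem total {σ : Platform n → ℝ} (hσ : WOK f 𝒮 σ) (hb : badm f 𝒮 σ = 0) :
    ∑ z, σ z = Hm σ + ∑ S ∈ SA f 𝒮, mu f 𝒮 σ S := by
  have he : (∅ : Finset (Fin n)) ∈ SA f 𝒮 :=
    Finset.mem_filter.2 ⟨h𝒮.2.2.2.2.2.2.1, Finset.empty_subset _⟩
  have h1 := nu_eq hf h𝒮 hσ hb he
  simp only [Finset.empty_subset, Finset.filter_true] at h1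
  rw [← h1]
  unfold Hm nu
  rw [← Finset.sum_filter_add_sum_filter_not univ (fun z : Platform n => z.1 = Policy.h)]
  congr 1
  apply sum_filter_supp
  intro z _
  cases z.1 <;> simp

end

theorem scale_payoff (q : ℝ) (f : Fin n → Policy → ℝ) (σ : Platform n → ℝ) {c : ℝ} (hc : c ≠ 0)
    (z : Platform n) : payoff q f (fun z => c * σ z) z = payoff q f σ z := by
  simp only [payoff_eq]
  congr 1
  unfold condProb
  rw [← Finset.mul_sum, ← Finset.mul_sum, mul_left_comm, mul_div_mul_left _ _ hc]

end FN

/-- In the fragmented-society model with the dynamic adjustment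
process (starting from any full-support distribution, in each period mixing the
current distribution with a point mass on a payoff-maximizing platform with weight
`1/(t+1)`), every limit point `σ` of the sequence `(σ_t)` induces the same joint
distribution over policy–coalition pairs `(a,C)` as the unique essential
equilibrium `σ*`. -/
theorem frag_dynamics_converge
    (n : ℕ) (q : ℝ) (hq0 : 0 < q) (hq1 : q ≤ 1)
    (f : Fin n → Policy → ℝ) (hf : FN.FOK f)
    (𝒮 : Finset (Finset (Fin n))) (h𝒮 : FN.FamilyOK f 𝒮)
    (σs : ℕ → Platform n → ℝ) (zbar : ℕ → Platform n)
    (hinit : FN.IsDist (σs 1))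
    (hfull : ∀ z, 0 < σs 1 z ↔ FN.Valid f (FN.fragFeas 𝒮) z)
    (hmax : ∀ t, 1 ≤ t → FN.Valid f (FN.fragFeas 𝒮) (zbar t) ∧
        ∀ z, FN.Valid f (FN.fragFeas 𝒮) z →
          FN.payoff q f (σs t) z ≤ FN.payoff q f (σs t) (zbar t))
    (hupd : ∀ t, 1 ≤ t → ∀ z, σs (t + 1) z =
        (if z = zbar t then (1 : ℝ) / (t + 1) else 0) + (t / (t + 1)) * σs t z)
    (σ : Platform n → ℝ) (φ : ℕ → ℕ) (hφ : StrictMono φ)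
    (hlim : ∀ z, Filter.Tendsto (fun k => σs (φ k) z) Filter.atTop (nhds (σ z)))
    (σstar : Platform n → ℝ) (hstar : FN.Essential q f (FN.fragFeas 𝒮) σstar) :
    ∀ (a : Policy) (C : Finset (Fin n)),
      ∑ S : Narrative n, σ (a, C, S) = ∑ S : Narrative n, σstar (a, C, S) := by
  classical
  obtain ⟨hSok, hSsum, hSoff, hSbad, hSH, hSL⟩ := FN.equil hf h𝒮 hq0 hstar.1
  have hV := FN.Vpos hf h𝒮
  have h𝒮' := h𝒮
  -- the scaled process
  let w : ℕ → Platform n → ℝ := fun k z => ((k : ℝ) + 1) * σs (k + 1) z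
  let y : ℕ → Platform n := fun k => zbar (k + 1)
  have hkp : ∀ k : ℕ, ((k : ℝ) + 1) ≠ 0 := fun k => by positivity
  have hw0 : ∀ z, 0 ≤ w 0 z := fun z => by simpa [w] using hinit.1 z
  have hws : ∑ z, w 0 z = 1 := by simpa [w] using hinit.2
  have hfl : ∀ z, 0 < w 0 z ↔ FN.Valid f (FN.fragFeas 𝒮) z := fun z => by
    simpa [w] using hfull z
  have hmx : ∀ k, FN.Valid f (FN.fragFeas 𝒮) (y k) ∧ ∀ z, FN.Valid f (FN.fragFeas 𝒮) z →
      FN.payoff q f (w k) z ≤ FN.payoff q f (w k) (y k) := by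
    intro k
    refine ⟨(hmax (k+1) (by omega)).1, fun z hz => ?_⟩
    have := (hmax (k+1) (by omega)).2 z hz
    simp only [w]
    rw [FN.scale_payoff q f _ (hkp k), FN.scale_payoff q f _ (hkp k)]
    exact this
  have hst : ∀ k z, w (k + 1) z = w k z + if z = y k then 1 else 0 := by
    intro k z
    have := hupd (k+1) (by omega) z
    simp only [w, y]
    rw [this]
    have h2 : ((k : ℝ) + 1 + 1) ≠ 0 := by positivity
    push_cast
    split_ifs
    · field_simp
      ring
    · field_simp
      ring
  have hok := FN.dyn_ok hf h𝒮 hq0 hw0 hws hfl hmx hst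
  obtain ⟨cb, hcb⟩ := FN.dyn_bad hf h𝒮 hq0 hw0 hws hfl hmx hst
  have hoffb := FN.dyn_hoff hf h𝒮 hq0 hw0 hws hfl hmx hst
  -- sums
  have hsumw : ∀ (s : Finset (Platform n)) (t : ℕ), 1 ≤ t →
      (t : ℝ) * ∑ z ∈ s, σs t z = ∑ z ∈ s, w (t - 1) z := by
    intro s t ht
    obtain ⟨k, rfl⟩ := Nat.exists_eq_add_of_le' ht
    simp only [w, Nat.add_sub_cancel, Finset.mul_sum]
    push_cast
    rfl
  have hlims : ∀ s : Finset (Platform n),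
      Filter.Tendsto (fun k => ∑ z ∈ s, σs (φ k) z) Filter.atTop (nhds (∑ z ∈ s, σ z)) :=
    fun s => tendsto_finsetSum s fun z _ => hlim z
  have hev1 : ∀ᶠ k in Filter.atTop, 1 ≤ φ k := by
    filter_upwards [Filter.eventually_ge_atTop 1] with k hk
    exact hk.trans (hφ.id_le k)
  have hσok : FN.WOK f 𝒮 σ := by
    have hz : ∀ t, 1 ≤ t → ∀ z, 0 ≤ σs t z ∧ (¬ FN.Valid f (FN.fragFeas 𝒮) z → σs t z = 0) := by
      intro t ht z
      obtain ⟨k, rfl⟩ := Nat.exists_eq_add_of_le' ht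
      have h1 := (hok k).1.1 z
      have hp : (0:ℝ) < (k:ℝ) + 1 := by positivity
      refine ⟨nonneg_of_mul_nonneg_right h1 hp, fun hv => ?_⟩
      have h2 := (hok k).1.2 z hv
      exact (mul_eq_zero.1 h2).resolve_left (hkp k)
    refine ⟨fun z => ge_of_tendsto (hlim z) ?_, fun z hv => ?_⟩
    · filter_upwards [hev1] with k hk using (hz _ hk z).1
    · refine tendsto_nhds_unique_of_eventuallyEq (hlim z) (tendsto_const_nhds (x := (0:ℝ))) ?_
      filter_upwards [hev1] with k hk using (hz _ hk z).2 hv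
  have hσsum : ∑ z, σ z = 1 := by
    have hone : ∀ k, ∑ z, w k z = (k : ℝ) + 1 := by
      intro k
      induction k with
      | zero => simpa using hws
      | succ k ih =>
        have := FN.step_sum (hst k) (fun _ => True)
        simp only [Finset.filter_true, if_true] at this
        rw [this, ih]; push_cast; ring
    refine tendsto_nhds_unique_of_eventuallyEq (hlims univ) (tendsto_const_nhds (x := (1:ℝ))) ?_
    filter_upwards [hev1] with k hk
    have h1 := hsumw univ (φ k) hk
    rw [hone] at h1
    have hp : (0:ℝ) < φ k := by exact_mod_cast hk
    have h2 : (((φ k - 1 : ℕ) : ℝ)) + 1 = φ k := by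
      rw [Nat.cast_sub hk]; simp
    rw [h2] at h1
    exact mul_left_cancel₀ hp.ne' (by rw [h1, mul_one])
  have hσoff : FN.hoff f σ = 0 := by
    refine FN.lim_zero hφ (hlims _) (c := 1) fun k hk => ?_
    rw [hsumw _ _ hk, abs_of_nonneg (Finset.sum_nonneg fun z _ => (hok _).1.1 z)]
    exact hoffb _
  have hσbad : FN.badm f 𝒮 σ = 0 := by
    refine FN.lim_zero hφ (hlims _) (c := cb) fun k hk => ?_
    rw [hsumw _ _ hk, abs_of_nonneg (Finset.sum_nonneg fun z _ => (hok _).1.1 z)]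
    exact hcb _
  have hmu : ∀ S ∈ FN.SA f 𝒮, FN.mu f 𝒮 σ S =
      FN.Hm σ * (FN.mu f 𝒮 σstar S / FN.Hm σstar) := by
    intro S hS
    obtain ⟨c, hc⟩ := FN.dyn_mu hf h𝒮 hq0 hw0 hws hfl hmx hst
      (m := fun S => FN.mu f 𝒮 σstar S / FN.Hm σstar)
      (fun S => div_nonneg (FN.mu_nonneg hf h𝒮 hSok S) hSH.le)
      (by
        intro S hS
        have h1 := (hSL S hS).1
        rw [FN.nu_eq hf h𝒮 hSok hSbad hS] at h1
        rw [← Finset.sum_div, ← mul_div_assoc, le_div_iff₀ hSH]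
        linarith)
      (by
        intro S hS hpos
        have h1 := (hSL S hS).2 ((div_pos_iff_of_pos_right hSH).1 hpos)
        rw [FN.nu_eq hf h𝒮 hSok hSbad hS] at h1
        rw [← Finset.sum_div, ← mul_div_assoc, div_le_iff₀ hSH]
        linarith) S hS
    rw [← sub_eq_zero]
    refine FN.lim_zero hφ ((hlims _).sub ((hlims _).mul_const _)) (c := c) fun k hk => ?_
    rw [mul_sub, ← mul_assoc, hsumw _ _ hk, hsumw _ _ hk]
    exact hc _
  have hHH : FN.Hm σ = FN.Hm σstar := by
    have h1 := FN.total hf h𝒮 hσok hσbad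
    have h2 := FN.total hf h𝒮 hSok hSbad
    rw [hσsum, Finset.sum_congr rfl hmu, ← Finset.mul_sum, ← Finset.sum_div] at h1
    rw [hSsum] at h2
    have h3 : FN.Hm σstar = FN.Hm σ * (FN.Hm σstar + ∑ S ∈ FN.SA f 𝒮, FN.mu f 𝒮 σstar S) := by
      field_simp at h1
      linarith
    rw [← h2, mul_one] at h3
    exact h3.symm
  intro a C
  cases a with
  | h => rw [FN.marg_h hf h𝒮 hσok hσoff, FN.marg_h hf h𝒮 hSok hSoff, hHH]
  | l =>
    rw [FN.marg_l hf h𝒮 hσok hσbad, FN.marg_l hf h𝒮 hSok hSbad]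
    split_ifs with h
    · rw [hmu _ h.1, hHH]
      field_simp
    · rfl
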